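/- Let G be a connected graph with more than one edge that is not a cycle. Then the bicircular matroid B(G) is connected if and only if G has no vertices of degree 1. -/

import Mathlib

/-- A matroid automorphism, modelled as a permutation of the ambient type that fixes
every point outside the ground set and preserves independence. -/
def IsMAuto {α : Type*} (M : Matroid α) (σ : Equiv.Perm α) : Prop :=
  (∀ x ∉ M.E, σ x = x) ∧ ∀ I : Set α, M.Indep (σ '' I) ↔ M.Indep I

/-- The automorphism group of a matroid, as a subgroup of `Equiv.Perm α`. -/
def matroidAutGroup {α : Type*} (M : Matroid α) : Subgroup (Equiv.Perm α) where
  carrier := {σ | IsMAuto M σ}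
  one_mem' := ⟨fun _ _ => rfl, fun I => by simp⟩
  mul_mem' := by
    rintro σ τ ⟨hσ1, hσ2⟩ ⟨hτ1, hτ2⟩
    refine ⟨fun x hx => ?_, fun I => ?_⟩
    · simp [Equiv.Perm.mul_apply, hτ1 x hx, hσ1 x hx]
    · rw [Equiv.Perm.coe_mul, Set.image_comp, hσ2, hτ2]
  inv_mem' := by
    rintro σ ⟨hσ1, hσ2⟩
    refine ⟨fun x hx => ?_, fun I => ?_⟩
    · have := hσ1 x hx
      simp only [Equiv.Perm.inv_def, Equiv.symm_apply_eq]
      exact this.symm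
    · have h := hσ2 ((σ⁻¹ : Equiv.Perm α) '' I)
      exact (by rwa [Set.image_image, show (fun x => σ (σ⁻¹ x)) = id by
        funext x; simp, Set.image_id] at h : M.Indep I ↔ M.Indep (⇑σ⁻¹ '' I)).symm

/-- A fixing set of a matroid: a subset of the ground set whose pointwise
stabilizer in the automorphism group is trivial. -/
def IsFixingSet {α : Type*} (M : Matroid α) (A : Set α) : Prop :=
  A ⊆ M.E ∧ ∀ σ : Equiv.Perm α, IsMAuto M σ → (∀ a ∈ A, σ a = a) → σ = 1

/-- The fixing number of a matroid: the least size of a fixing set. -/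
noncomputable def fixNum {α : Type*} (M : Matroid α) : ℕ :=
  sInf {k | ∃ A : Set α, IsFixingSet M A ∧ A.Finite ∧ A.ncard = k}

/-- A circuit of a matroid: a minimal dependent subset of the ground set. -/
def MCirc {α : Type*} (M : Matroid α) (C : Set α) : Prop :=
  C ⊆ M.E ∧ ¬ M.Indep C ∧ ∀ D ⊂ C, M.Indep D

/-- The vertex support of a set of edges. -/
def edgeSupp {V : Type*} (C : Set (Sym2 V)) : Set V := {v | ∃ e ∈ C, v ∈ e}

/-- A set of edges is connected if it is nonempty and any two supported vertices are
joined by a walk using only these edges. -/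
def EdgeConn {V : Type*} (C : Set (Sym2 V)) : Prop :=
  C.Nonempty ∧ ∀ u ∈ edgeSupp C, ∀ v ∈ edgeSupp C, (SimpleGraph.fromEdgeSet C).Reachable u v

/-- The edge set of a cycle of the graph `G`. -/
def IsCycleSet {V : Type*} (G : SimpleGraph V) (C : Set (Sym2 V)) : Prop :=
  ∃ (v : V) (w : G.Walk v v), w.IsCycle ∧ C = {e | e ∈ w.edges}

/-- A bicycle of `G`: a minimal connected edge set with more edges than vertices,
equivalently a subdivision of two loops at a vertex, two loops joined by an edge,
or three edges joining the same pair of vertices. -/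
def IsBicycle {V : Type*} (G : SimpleGraph V) (C : Set (Sym2 V)) : Prop :=
  C ⊆ G.edgeSet ∧ C.Finite ∧ EdgeConn C ∧ (edgeSupp C).ncard < C.ncard ∧
    ∀ D ⊂ C, ¬ (EdgeConn D ∧ D.Finite ∧ (edgeSupp D).ncard < D.ncard)


theorem hallDef {ι β : Type*} [DecidableEq ι] [DecidableEq β] (S : Finset ι)
    (t : ι → Finset β) :
    ∃ X ⊆ S, ∃ I : Finset β, I ⊆ S.biUnion t ∧
      (∀ D ⊆ I, D.card ≤ (S.filter (fun v => ∃ e ∈ D, e ∈ t v)).card) ∧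
      S.card + (X.biUnion t).card ≤ I.card + X.card := by
  obtain ⟨X, hXS, hX⟩ := Finset.exists_max_image S.powerset
    (fun X => (X.card : ℤ) - (X.biUnion t).card) ⟨∅, by simp⟩
  have h0 := hX ∅ (by simp)
  simp only [Finset.card_empty, Finset.biUnion_empty] at h0
  obtain ⟨d, hd⟩ : ∃ d : ℕ, (X.biUnion t).card + d = X.card :=
    ⟨X.card - (X.biUnion t).card, by omega⟩
  let t' : S → Finset (β ⊕ Fin d) := fun v => (t v).disjSum Finset.univ
  have hall : ∀ s : Finset S, s.card ≤ (s.biUnion t').card := by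
    intro s
    rcases s.eq_empty_or_nonempty with rfl | hs
    · simp
    have h1 : s.biUnion t' = ((s.map (Function.Embedding.subtype _)).biUnion t).disjSum
        Finset.univ := by
      ext x
      rcases x with x | x
      · simp [t', Finset.mem_biUnion, Finset.inl_mem_disjSum]
      · simp only [t', Finset.mem_biUnion, Finset.inr_mem_disjSum, Finset.mem_univ]
        obtain ⟨a, ha⟩ := hs
        simp only [and_true, iff_true]
        exact ⟨a, ha⟩
    have h2 := hX (s.map (Function.Embedding.subtype _)) (by
      rw [Finset.mem_powerset]
      intro x hx
      simp only [Finset.mem_map, Function.Embedding.subtype_apply] at hx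
      obtain ⟨a, _, rfl⟩ := hx
      exact a.2)
    rw [h1, Finset.card_disjSum, Finset.card_univ, Fintype.card_fin]
    rw [Finset.card_map] at h2
    omega
  obtain ⟨f, hf, hft⟩ := (Finset.all_card_le_biUnion_card_iff_exists_injective t').1 hall
  have hmem : ∀ e, e ∈ (Finset.univ.image f).toLeft → ∃ v : S, f v = Sum.inl e ∧ e ∈ t v := by
    intro e he
    simp only [Finset.mem_toLeft, Finset.mem_image, Finset.mem_univ, true_and] at he
    obtain ⟨v, hv⟩ := he
    refine ⟨v, hv, ?_⟩
    have := hft v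
    rw [hv] at this
    simpa [t', Finset.inl_mem_disjSum] using this
  refine ⟨X, Finset.mem_powerset.1 hXS, (Finset.univ.image f).toLeft, ?_, ?_, ?_⟩
  · intro e he
    obtain ⟨v, _, hv⟩ := hmem e he
    exact Finset.mem_biUnion.2 ⟨v, v.2, hv⟩
  · intro D hD
    rcases D.eq_empty_or_nonempty with rfl | ⟨e0, he0⟩
    · simp
    have : Nonempty S := ⟨(hmem e0 (hD he0)).choose⟩
    choose! g hg using (fun e (he : e ∈ D) => hmem e (hD he))
    apply Finset.card_le_card_of_injOn (fun e => (g e : ι))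
    · intro e he
      simp only [Finset.coe_filter, Set.mem_ofPred_eq]
      exact ⟨(g e).2, e, he, (hg e he).2⟩
    · intro a ha b hb hab
      have : g a = g b := Subtype.ext hab
      have h1 := (hg a ha).1
      rw [this, (hg b hb).1] at h1
      exact (Sum.inl.inj h1).symm
  · have h1 := Finset.card_toLeft_add_card_toRight (u := Finset.univ.image f)
    rw [Finset.card_image_of_injective _ hf] at h1
    have h2 : (Finset.univ.image f).toRight.card ≤ d := by
      simpa using Finset.card_le_univ (Finset.univ.image f).toRight
    rw [Finset.card_univ, Fintype.card_coe] at h1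
    omega

theorem circTrans {α : Type*} [Finite α] (M : Matroid α) (x w : α) (C₁ C₂ : Set α)
    (h1 : M.IsCircuit C₁) (h2 : M.IsCircuit C₂) (hx : x ∈ C₁) (hw : w ∈ C₂)
    (hne : (C₁ ∩ C₂).Nonempty) : ∃ C, M.IsCircuit C ∧ x ∈ C ∧ w ∈ C := by
  induction hn : (C₁ ∪ C₂).ncard using Nat.strong_induction_on generalizing C₁ C₂ with
  | _ n ih =>
  by_contra hno
  have hxC2 : x ∉ C₂ := fun h => hno ⟨C₂, h2, h, hw⟩
  have hwC1 : w ∉ C₁ := fun h => hno ⟨C₁, h1, hx, h⟩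
  obtain ⟨e, he1, he2⟩ := hne
  have key : ∀ D₁ D₂ : Set α, M.IsCircuit D₁ → M.IsCircuit D₂ → x ∈ D₁ → w ∈ D₂ →
      (D₁ ∩ D₂).Nonempty → D₁ ∪ D₂ ⊆ C₁ ∪ C₂ → D₁ ∪ D₂ = C₁ ∪ C₂ := by
    intro D₁ D₂ k1 k2 kx kw kne ksub
    by_contra hneq
    have hlt : (D₁ ∪ D₂).ncard < n := by
      rw [← hn]
      exact Set.ncard_lt_ncard (ksub.ssubset_of_ne hneq) (Set.toFinite _)
    exact hno (ih _ hlt D₁ D₂ k1 k2 kx kw kne rfl)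
  obtain ⟨C₃, h3s, h3, hx3⟩ := h1.strong_elimination h2 he1 he2 hx hxC2
  obtain ⟨C₄, h4s, h4, hw4⟩ := h2.strong_elimination h1 he2 he1 hw hwC1
  have n3 : ∃ z ∈ C₃, z ∉ C₁ := by
    by_contra hh
    push Not at hh
    have := h3.eq_of_subset_isCircuit h1 hh
    rw [← this] at he1
    exact (h3s he1).2 rfl
  have n4 : ∃ z ∈ C₄, z ∉ C₂ := by
    by_contra hh
    push Not at hh
    have := h4.eq_of_subset_isCircuit h2 hh
    rw [← this] at he2
    exact (h4s he2).2 rfl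
  obtain ⟨z, hz3, hz1⟩ := n3
  obtain ⟨y, hy4, hy2⟩ := n4
  have hz2 : z ∈ C₂ := ((h3s hz3).1).resolve_left hz1
  have hy1 : y ∈ C₁ := ((h4s hy4).1).resolve_left hy2
  have e4 := key C₁ C₄ h1 h4 hx hw4 ⟨y, hy1, hy4⟩
    (Set.union_subset Set.subset_union_left (fun a ha => by
      rcases (h4s ha).1 with h | h
      · exact Or.inr h
      · exact Or.inl h))
  have hz4 : z ∈ C₄ := by
    have : z ∈ C₁ ∪ C₄ := by rw [e4]; exact Or.inr hz2
    exact this.resolve_left hz1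
  have e5 := key C₃ C₄ h3 h4 hx3 hw4 ⟨z, hz3, hz4⟩
    (Set.union_subset (fun a ha => (h3s ha).1) (fun a ha => by
      rcases (h4s ha).1 with h | h
      · exact Or.inr h
      · exact Or.inl h))
  have : e ∈ C₃ ∪ C₄ := by rw [e5]; exact Or.inl he1
  rcases this with h | h
  · exact (h3s h).2 rfl
  · exact (h4s h).2 rfl

theorem mcirc_iff {α : Type*} (M : Matroid α) (C : Set α) : MCirc M C ↔ M.IsCircuit C := by
  rw [Matroid.isCircuit_iff_forall_ssubset, Matroid.dep_iff]
  unfold MCirc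
  tauto

theorem edgeSupp_mono {V : Type*} {C D : Set (Sym2 V)} (h : C ⊆ D) : edgeSupp C ⊆ edgeSupp D :=
  fun _ ⟨e, he, hv⟩ => ⟨e, h he, hv⟩

theorem exists_bicycle {V : Type*} [Finite V] (G : SimpleGraph V) (I : Set (Sym2 V))
    (hI : I ⊆ G.edgeSet) (hc : (edgeSupp I).ncard < I.ncard) :
    ∃ C ⊆ I, IsBicycle G C := by
  obtain ⟨D, hDI, hD⟩ := (Set.toFinite {D : Set (Sym2 V) | D ⊆ I ∧
    (edgeSupp D).ncard < D.ncard}).exists_le_minimal (a := I) ⟨subset_rfl, hc⟩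
  have hDlt := hD.prop.2
  have hmin : ∀ D' ⊂ D, D'.ncard ≤ (edgeSupp D').ncard := by
    intro D' h'
    by_contra hh
    push Not at hh
    exact h'.2 (hD.2 ⟨h'.1.trans hDI, hh⟩ h'.1)
  refine ⟨D, hDI, hD.prop.1.trans hI, Set.toFinite _, ⟨?_, ?_⟩, hDlt, ?_⟩
  · rw [← Set.ncard_pos]
    omega
  · intro u hu v hv
    by_contra hnr
    set H := SimpleGraph.fromEdgeSet D with hH
    have hreach : ∀ e ∈ D, ∀ a ∈ e, ∀ b ∈ e, H.Reachable u a → H.Reachable u b := by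
      intro e he a ha b hb hr
      by_cases hab : a = b
      · exact hab ▸ hr
      have : e = s(a, b) := ((Sym2.mem_and_mem_iff hab).1 ⟨ha, hb⟩)
      refine hr.trans (SimpleGraph.Adj.reachable ?_)
      rw [hH, SimpleGraph.fromEdgeSet_adj]
      exact ⟨this ▸ he, hab⟩
    let D1 := {e ∈ D | ∃ a ∈ e, H.Reachable u a}
    let D2 := {e ∈ D | ¬ ∃ a ∈ e, H.Reachable u a}
    obtain ⟨eu, heu, hueu⟩ := hu
    obtain ⟨ev, hev, hvev⟩ := hv
    have s1 : D1 ⊂ D := by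
      refine ⟨fun e he => he.1, fun h => ?_⟩
      obtain ⟨_, a, ha, hr⟩ := h hev
      exact hnr (hreach ev hev a ha v hvev hr)
    have s2 : D2 ⊂ D := by
      refine ⟨fun e he => he.1, fun h => ?_⟩
      exact (h heu).2 ⟨u, hueu, SimpleGraph.Reachable.refl u⟩
    have c1 := hmin D1 s1
    have c2 := hmin D2 s2
    have hu : D1 ∪ D2 = D := by
      ext e
      simp only [D1, D2, Set.mem_union, Set.mem_ofPred_eq]
      rw [← and_or_left]
      exact and_iff_left (Classical.em _)
    have hd : Disjoint (edgeSupp D1) (edgeSupp D2) := by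
      rw [Set.disjoint_left]
      rintro a ⟨e, ⟨he, b, hb, hr⟩, hae⟩ ⟨e', ⟨he', hn'⟩, hae'⟩
      exact hn' ⟨a, hae', hreach e he b hb a hae hr⟩
    have k1 := Set.ncard_union_le D1 D2
    have k2 := Set.ncard_union_eq hd
    have k3 : (edgeSupp D1 ∪ edgeSupp D2).ncard ≤ (edgeSupp D).ncard :=
      Set.ncard_le_ncard (Set.union_subset (edgeSupp_mono s1.1) (edgeSupp_mono s2.1))
    rw [hu] at k1
    omega
  · rintro D' h' ⟨_, _, h3⟩
    have := hmin D' h'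
    omega

theorem two_regular_cycle {V : Type*} [Fintype V] (G : SimpleGraph V) 
    (hconn : G.Connected) (h2 : ∀ v, (G.neighborSet v).ncard = 2) :
    IsCycleSet G G.edgeSet := by
  classical
  have hcyc : G.IsCycles := fun v _ => h2 v
  obtain ⟨v⟩ := hconn.nonempty
  have hn : (G.neighborSet v).Nonempty := by
    rw [← Set.ncard_pos, h2]; norm_num
  obtain ⟨p, hp, hs⟩ := hcyc.exists_cycle_toSubgraph_verts_eq_connectedComponentSupp
    (c := G.connectedComponentMk v) (v := v) rfl hn
  refine ⟨v, p, hp, ?_⟩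
  ext e
  induction e with | _ a b =>
  have ha : a ∈ p.toSubgraph.verts := by
    rw [hs, SimpleGraph.ConnectedComponent.mem_supp_iff, SimpleGraph.ConnectedComponent.eq]
    exact hconn.preconnected a v
  simp only [SimpleGraph.mem_edgeSet, Set.mem_ofPred_eq]
  rw [← hp.adj_toSubgraph_iff_of_isCycles hcyc ha, ← SimpleGraph.Walk.mem_edges_toSubgraph,
    SimpleGraph.Subgraph.mem_edgeSet]

theorem deg_one_not_mem {V : Type*} [Finite V] (G : SimpleGraph V) (v w : V) (hvw : v ≠ w)
    (hdeg : ∀ e ∈ G.edgeSet, v ∈ e → e = s(v, w)) (C : Set (Sym2 V)) (hC : IsBicycle G C)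
    (f : Sym2 V) (hf : f ∈ C) (hfe : f ≠ s(v, w)) : s(v, w) ∉ C := by
  intro he
  obtain ⟨hCE, hfin, ⟨hne, hcon⟩, hlt, hmin⟩ := hC
  classical
  refine hmin (C \ {s(v, w)}) ⟨Set.sdiff_subset, fun h => (h he).2 rfl⟩ ⟨⟨⟨f, hf, hfe⟩, ?_⟩,
    Set.toFinite _, ?_⟩
  · let φ : V → V := fun a => if a = v then w else a
    have hφ : ∀ a b, (SimpleGraph.fromEdgeSet C).Reachable a b →
        (SimpleGraph.fromEdgeSet (C \ {s(v, w)})).Reachable (φ a) (φ b) := by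
      rintro a b ⟨p⟩
      induction p with
      | nil => exact SimpleGraph.Reachable.refl _
      | @cons a b c hab _ ih =>
        refine SimpleGraph.Reachable.trans ?_ ih
        rw [SimpleGraph.fromEdgeSet_adj] at hab
        by_cases hv : s(a, b) = s(v, w)
        · have : φ a = φ b := by
            rcases Sym2.eq_iff.1 hv with ⟨rfl, rfl⟩ | ⟨rfl, rfl⟩ <;> simp [φ]
          rw [this]
        · have ha : a ≠ v := fun h => hv (hdeg _ (hCE hab.1) (by simp [h]))
          have hb : b ≠ v := fun h => hv (hdeg _ (hCE hab.1) (by simp [h]))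
          simp only [φ, ha, hb, if_false]
          apply SimpleGraph.Adj.reachable
          rw [SimpleGraph.fromEdgeSet_adj]
          exact ⟨⟨hab.1, hv⟩, hab.2⟩
    have hsv : ∀ a ∈ edgeSupp (C \ {s(v, w)}), a ≠ v := by
      rintro a ⟨e, he, hae⟩ rfl
      exact he.2 (hdeg e (hCE he.1) hae)
    intro a ha b hb
    have := hφ a b (hcon a (edgeSupp_mono Set.sdiff_subset ha) b (edgeSupp_mono Set.sdiff_subset hb))
    simpa [φ, hsv a ha, hsv b hb] using this
  · have h1 : edgeSupp (C \ {s(v, w)}) ⊆ edgeSupp C \ {v} := by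
      rintro a ⟨e, he, hae⟩
      refine ⟨⟨e, he.1, hae⟩, ?_⟩
      rintro rfl
      exact he.2 (hdeg e (hCE he.1) hae)
    have h2 := Set.ncard_le_ncard h1 (Set.toFinite _)
    have h3 : v ∈ edgeSupp C := ⟨_, he, by simp⟩
    have h4 := Set.ncard_sdiff_singleton_add_one h3 (Set.toFinite _)
    have h5 := Set.ncard_sdiff_singleton_add_one he (Set.toFinite _)
    omega

theorem sideCount {V : Type*} [DecidableEq V] (A : Finset (Sym2 V)) (K X : Finset V)
    (h2 : ∀ v ∈ X, (if v ∈ K then 1 else 2) ≤ (A.filter (fun e => v ∈ e)).card) :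
    2 * X.card ≤ 2 * (X.biUnion (fun v => A.filter (fun e => v ∈ e))).card + K.card ∧
    (2 * X.card = 2 * (X.biUnion (fun v => A.filter (fun e => v ∈ e))).card + K.card →
      K ⊆ X ∧ (∀ v ∈ X, ∀ e ∈ A, v ∈ e → ∀ w ∈ e, w ∈ X) ∧
      ∀ v ∈ X, (A.filter (fun e => v ∈ e)).card = if v ∈ K then 1 else 2) := by
  set N := X.biUnion (fun v => A.filter (fun e => v ∈ e)) with hN
  have hdc : ∑ v ∈ X, (A.filter (fun e => v ∈ e)).card
      = ∑ e ∈ N, (X.filter (fun v => v ∈ e)).card := by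
    refine Eq.trans ?_ (Finset.sum_card_bipartiteAbove_eq_sum_card_bipartiteBelow
      (s := X) (t := N) (fun v e => v ∈ e))
    refine Finset.sum_congr rfl fun v hv => ?_
    congr 1
    ext e
    simp only [Finset.mem_bipartiteAbove, Finset.mem_filter, hN, Finset.mem_biUnion]
    constructor
    · rintro ⟨h1, h2⟩
      exact ⟨⟨v, hv, h1, h2⟩, h2⟩
    · rintro ⟨⟨_, _, h1, _⟩, h2⟩
      exact ⟨h1, h2⟩
  have hsub : ∀ e : Sym2 V, X.filter (fun v => v ∈ e) ⊆ e.toFinset := by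
    intro e v hv
    rw [Sym2.mem_toFinset]
    exact (Finset.mem_filter.1 hv).2
  have hle2 : ∀ e : Sym2 V, e.toFinset.card ≤ 2 := by
    intro e
    rw [Sym2.card_toFinset]
    split_ifs <;> omega
  have hb : ∀ e ∈ N, (X.filter (fun v => v ∈ e)).card ≤ 2 := fun e _ =>
    (Finset.card_le_card (hsub e)).trans (hle2 e)
  have u1 : ∑ e ∈ N, (X.filter (fun v => v ∈ e)).card ≤ ∑ e ∈ N, 2 := Finset.sum_le_sum hb
  have u2 : ∑ e ∈ N, 2 = 2 * N.card := by simp [mul_comm]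
  have l1 := Finset.sum_le_sum h2
  have l2 : ∑ v ∈ X, (if v ∈ K then 1 else 2) + (X ∩ K).card = 2 * X.card := by
    rw [← Finset.filter_mem_eq_inter, Finset.card_filter, ← Finset.sum_add_distrib, mul_comm,
      ← smul_eq_mul, ← Finset.sum_const]
    refine Finset.sum_congr rfl fun v _ => ?_
    split_ifs <;> rfl
  have l3 : (X ∩ K).card ≤ K.card := Finset.card_le_card Finset.inter_subset_right
  refine ⟨by omega, fun heq => ⟨?_, ?_, ?_⟩⟩
  · have : X ∩ K = K := Finset.eq_of_subset_of_card_le Finset.inter_subset_right (by omega)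
    exact Finset.inter_eq_right.1 this
  · have hE := (Finset.sum_eq_sum_iff_of_le hb).1 (by omega)
    intro v hv e he hve w hw
    have h3 := hE e (Finset.mem_biUnion.2 ⟨v, hv, Finset.mem_filter.2 ⟨he, hve⟩⟩)
    have h4 := Finset.eq_of_subset_of_card_le (hsub e) (by have := hle2 e; omega)
    have : w ∈ X.filter (fun v => v ∈ e) := by rw [h4, Sym2.mem_toFinset]; exact hw
    exact (Finset.mem_filter.1 this).1
  · intro v hv
    exact ((Finset.sum_eq_sum_iff_of_le h2).1 (by omega) v hv).symm

theorem hallEdge {V : Type*} [Fintype V] [DecidableEq V] (A : Finset (Sym2 V)) :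
    ∃ X ⊆ Finset.univ.filter (fun v => ∃ e ∈ A, v ∈ e), ∃ I ⊆ A,
      (∀ D ⊆ I, D.card ≤ (edgeSupp (D : Set (Sym2 V))).ncard) ∧
      (Finset.univ.filter (fun v => ∃ e ∈ A, v ∈ e)).card +
        (X.biUnion (fun v => A.filter (fun e => v ∈ e))).card ≤ I.card + X.card := by
  obtain ⟨X, hX, I, hI, hD, hc⟩ := hallDef (Finset.univ.filter (fun v => ∃ e ∈ A, v ∈ e))
    (fun v => A.filter (fun e => v ∈ e))
  refine ⟨X, hX, I, ?_, ?_, hc⟩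
  · intro e he
    obtain ⟨v, _, hv⟩ := Finset.mem_biUnion.1 (hI he)
    exact (Finset.mem_filter.1 hv).1
  · intro D hDI
    refine (hD D hDI).trans ?_
    rw [← Set.ncard_coe_finset]
    refine Set.ncard_le_ncard ?_ (Set.toFinite _)
    intro v hv
    obtain ⟨_, e, he, hve⟩ := Finset.mem_filter.1 (Finset.mem_coe.1 hv)
    exact ⟨e, he, (Finset.mem_filter.1 hve).2⟩

theorem closed_univ {V : Type*} (G : SimpleGraph V) (hconn : G.Connected) (S : Set V) (u : V)
    (hu : u ∈ S) (hS : ∀ a ∈ S, ∀ b, G.Adj a b → b ∈ S) (v : V) : v ∈ S := by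
  obtain ⟨p⟩ := hconn.preconnected u v
  induction p with
  | nil => exact hu
  | cons h _ ih => exact ih (hS _ hu _ h)

theorem separation {V : Type*} [Fintype V] [DecidableEq V] (G : SimpleGraph V)
    [DecidableRel G.Adj] (hconn : G.Connected) (A A' : Finset (Sym2 V))
    (hU : A ∪ A' = G.edgeFinset) (hdis : Disjoint A A') (hA : A.Nonempty) (hA' : A'.Nonempty)
    (hdeg : ∀ v, 2 ≤ G.degree v)
    (hI : ∀ I ⊆ A, ∀ I' ⊆ A', (∀ D ⊆ I, D.card ≤ (edgeSupp (D : Set (Sym2 V))).ncard) →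
      (∀ D ⊆ I', D.card ≤ (edgeSupp (D : Set (Sym2 V))).ncard) →
      I.card + I'.card ≤ Fintype.card V) :
    IsCycleSet G G.edgeSet := by
  have hds : ∀ v, (A.filter (fun e => v ∈ e)).card + (A'.filter (fun e => v ∈ e)).card
      = G.degree v := by
    intro v
    rw [← G.card_incidenceFinset_eq_degree, G.incidenceFinset_eq_filter, ← hU,
      Finset.filter_union, Finset.card_union_of_disjoint]
    exact Finset.disjoint_filter_filter hdis
  set S := Finset.univ.filter (fun v => ∃ e ∈ A, v ∈ e) with hS
  set S' := Finset.univ.filter (fun v => ∃ e ∈ A', v ∈ e) with hS'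
  have mS : ∀ v, v ∈ S ↔ 1 ≤ (A.filter (fun e => v ∈ e)).card := by
    intro v
    rw [Nat.one_le_iff_ne_zero, ← Nat.pos_iff_ne_zero, Finset.card_pos,
      Finset.filter_nonempty_iff]
    simp [hS]
  have mS' : ∀ v, v ∈ S' ↔ 1 ≤ (A'.filter (fun e => v ∈ e)).card := by
    intro v
    rw [Nat.one_le_iff_ne_zero, ← Nat.pos_iff_ne_zero, Finset.card_pos,
      Finset.filter_nonempty_iff]
    simp [hS']
  have mK : ∀ v, v ∈ S ∩ S' ↔ v ∈ S ∧ v ∈ S' := fun v => Finset.mem_inter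
  obtain ⟨X, hX, I, hIA, hID, hIc⟩ := hallEdge A
  obtain ⟨X', hX', I', hIA', hID', hIc'⟩ := hallEdge A'
  rw [← hS] at hX hIc
  rw [← hS'] at hX' hIc'
  have hII := hI I hIA I' hIA' hID hID'
  have hSS : S ∪ S' = Finset.univ := by
    ext v
    simp only [Finset.mem_union, Finset.mem_univ, iff_true, mS, mS']
    have := hds v
    have := hdeg v
    omega
  have hcard := Finset.card_union_add_card_inter S S'
  rw [hSS, Finset.card_univ] at hcard
  obtain ⟨k1, k2⟩ := sideCount A (S ∩ S') X (by
    intro v hv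
    have h1 := hX hv
    have h2 := hds v
    have h3 := hdeg v
    have h4 := mK v
    rw [mS] at h1
    rw [mS, mS'] at h4
    split_ifs with hK <;> rw [h4] at hK <;> omega)
  obtain ⟨k1', k2'⟩ := sideCount A' (S ∩ S') X' (by
    intro v hv
    have h1 := hX' hv
    have h2 := hds v
    have h3 := hdeg v
    have h4 := mK v
    rw [mS'] at h1
    rw [mS, mS'] at h4
    split_ifs with hK <;> rw [h4] at hK <;> omega)
  obtain ⟨q1, q2, q3⟩ := k2 (by omega)
  obtain ⟨q1', q2', q3'⟩ := k2' (by omega)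
  have hAG : ∀ a b, G.Adj a b → s(a, b) ∈ A ∨ s(a, b) ∈ A' := by
    intro a b hab
    rw [← Finset.mem_union, hU, SimpleGraph.mem_edgeFinset]
    exact hab
  have hne : ∃ u, u ∈ S ∩ S' := by
    by_contra hno
    push Not at hno
    obtain ⟨e, he⟩ := hA
    obtain ⟨e', he'⟩ := hA'
    induction e with | _ a b =>
    induction e' with | _ c d =>
    have hcS : c ∈ (S : Set V) := by
      apply closed_univ G hconn (S : Set V) a
      · exact Finset.mem_coe.2 (Finset.mem_filter.2 ⟨Finset.mem_univ _, _, he, by simp⟩)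
      · intro x hx y hxy
        rcases hAG x y hxy with h | h
        · exact Finset.mem_coe.2 (Finset.mem_filter.2 ⟨Finset.mem_univ _, _, h, by simp⟩)
        · exact absurd (Finset.mem_inter.2 ⟨hx, Finset.mem_filter.2
            ⟨Finset.mem_univ _, _, h, by simp⟩⟩) (hno x)
    exact hno c (Finset.mem_inter.2 ⟨hcS, Finset.mem_filter.2
      ⟨Finset.mem_univ _, _, he', by simp⟩⟩)
  obtain ⟨u, hu⟩ := hne
  have hall : ∀ v, v ∈ (↑(X ∪ X') : Set V) := by
    apply closed_univ G hconn _ u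
    · exact Finset.mem_coe.2 (Finset.mem_union_left _ (q1 hu))
    · intro x hx y hxy
      have hA1 : x ∈ X → s(x, y) ∈ A → y ∈ X := fun hx h => q2 x hx _ h (by simp) y (by simp)
      have hA2 : x ∈ X' → s(x, y) ∈ A' → y ∈ X' := fun hx h => q2' x hx _ h (by simp) y (by simp)
      have hs : s(x, y) ∈ A → x ∈ S := fun h =>
        Finset.mem_filter.2 ⟨Finset.mem_univ _, _, h, by simp⟩
      have hs' : s(x, y) ∈ A' → x ∈ S' := fun h =>
        Finset.mem_filter.2 ⟨Finset.mem_univ _, _, h, by simp⟩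
      simp only [Finset.coe_union, Set.mem_union, Finset.mem_coe] at hx ⊢
      rcases hAG x y hxy with h | h
      · left
        refine hA1 ?_ h
        rcases hx with hx | hx
        · exact hx
        · exact q1 (Finset.mem_inter.2 ⟨hs h, hX' hx⟩)
      · right
        refine hA2 ?_ h
        rcases hx with hx | hx
        · exact q1' (Finset.mem_inter.2 ⟨hX hx, hs' h⟩)
        · exact hx
  apply two_regular_cycle G hconn
  intro v
  rw [← Nat.card_coe_set_eq, Nat.card_eq_fintype_card, SimpleGraph.card_neighborSet_eq_degree,
    ← hds v]
  have hv := hall v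
  simp only [Finset.coe_union, Set.mem_union, Finset.mem_coe] at hv
  by_cases hK : v ∈ S ∩ S'
  · have e1 := q3 v (q1 hK)
    have e2 := q3' v (q1' hK)
    rw [if_pos hK] at e1 e2
    omega
  · rcases hv with hv | hv
    · have e1 := q3 v hv
      rw [if_neg hK] at e1
      have : ¬ v ∈ S' := fun h => hK (Finset.mem_inter.2 ⟨hX hv, h⟩)
      rw [mS'] at this
      omega
    · have e1 := q3' v hv
      rw [if_neg hK] at e1
      have : ¬ v ∈ S := fun h => hK (Finset.mem_inter.2 ⟨h, hX' hv⟩)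
      rw [mS] at this
      omega

/-- (Matthews) Let `G` be a connected graph with more than one edge which is not a
cycle. Then the bicircular matroid `B(G)` is connected (every two elements lie in a
common circuit) if and only if `G` has no vertices of degree 1. -/
theorem stmt16 {V : Type*} [Fintype V] [DecidableEq V] (G : SimpleGraph V)
    [DecidableRel G.Adj]
    (hconn : G.Connected) (hedges : 1 < G.edgeSet.ncard)
    (hnotcycle : ¬ IsCycleSet G G.edgeSet)
    (B : Matroid (Sym2 V)) (hBE : B.E = G.edgeSet)
    (hBC : ∀ C : Set (Sym2 V), MCirc B C ↔ IsBicycle G C) :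
    (∀ x ∈ B.E, ∀ y ∈ B.E, x = y ∨ ∃ C : Set (Sym2 V), MCirc B C ∧ x ∈ C ∧ y ∈ C) ↔
      ∀ v : V, G.degree v ≠ 1 := by
  classical
  constructor
  · intro h v hv
    rw [SimpleGraph.degree_eq_one_iff_existsUnique_adj] at hv
    obtain ⟨w, hw, huniq⟩ := hv
    obtain ⟨f, hf, hfe⟩ := Set.exists_ne_of_one_lt_ncard hedges s(v, w)
    have hdeg : ∀ e ∈ G.edgeSet, v ∈ e → e = s(v, w) := by
      intro e he hve
      obtain ⟨b, rfl⟩ := Sym2.mem_iff_exists.1 hve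
      rw [huniq b he]
    rcases h f (hBE ▸ hf) s(v, w) (by rw [hBE]; exact hw) with h | ⟨C, hC, h1, h2⟩
    · exact hfe h
    · exact deg_one_not_mem G v w hw.ne hdeg C ((hBC C).1 hC) f h1 hfe h2
  · intro hdeg1 x hx y hy
    by_contra hno
    push Not at hno
    obtain ⟨hxy, hno⟩ := hno
    have hnt : Nontrivial V := by
      rw [hBE] at hx
      induction x with | _ a b =>
      exact ⟨a, b, G.ne_of_adj hx⟩
    have hdeg : ∀ v, 2 ≤ G.degree v := by
      intro v
      have h1 := hconn.preconnected.degree_pos_of_nontrivial v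
      have h2 := hdeg1 v
      omega
    let P : Sym2 V → Prop := fun z => z = x ∨ ∃ C, B.IsCircuit C ∧ x ∈ C ∧ z ∈ C
    have hP : ∀ C, B.IsCircuit C → ∀ z ∈ C, ∀ w ∈ C, P z → P w := by
      rintro C hC z hz w hw (rfl | ⟨C', hC', hx', hz'⟩)
      · exact Or.inr ⟨C, hC, hz, hw⟩
      · exact Or.inr (circTrans B x w C' C hC' hC hx' hw ⟨z, hz', hz⟩)
    have hsp : ∀ I : Finset (Sym2 V), I ⊆ G.edgeFinset →
        (∀ D ⊆ I, D.card ≤ (edgeSupp (D : Set (Sym2 V))).ncard) →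
        ∀ C : Set (Sym2 V), C ⊆ I → ¬ B.IsCircuit C := by
      intro I _ hD C hCI hC
      rw [← mcirc_iff, hBC] at hC
      have h1 := hC.2.2.2.1
      have h2 := hD C.toFinset (by
        intro e he
        exact Finset.mem_coe.1 (hCI (Set.mem_toFinset.1 he)))
      rw [Set.coe_toFinset, ← Set.ncard_eq_toFinset_card'] at h2
      omega
    apply hnotcycle
    apply separation G hconn (G.edgeFinset.filter P) (G.edgeFinset.filter (fun z => ¬ P z))
      (Finset.filter_union_filter_not_eq _ _) (Finset.disjoint_filter_filter_not _ _ _)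
      ⟨x, ?_⟩ ⟨y, ?_⟩ hdeg
    · intro I hIA I' hIA' hI hI'
      have sI := hIA.trans (Finset.filter_subset _ _)
      have sI' := hIA'.trans (Finset.filter_subset _ _)
      by_contra hlt
      push Not at hlt
      have hdj : Disjoint I I' := by
        rw [Finset.disjoint_left]
        intro a ha ha'
        exact (Finset.mem_filter.1 (hIA' ha')).2 (Finset.mem_filter.1 (hIA ha)).2
      have hsub : ((I ∪ I' : Finset (Sym2 V)) : Set (Sym2 V)) ⊆ G.edgeSet := by
        intro e he
        rw [← SimpleGraph.mem_edgeFinset]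
        rcases Finset.mem_union.1 (Finset.mem_coe.1 he) with h | h
        · exact sI h
        · exact sI' h
      obtain ⟨C, hCs, hC⟩ := exists_bicycle G _ hsub (by
        rw [Set.ncard_coe_finset, Finset.card_union_of_disjoint hdj]
        refine lt_of_le_of_lt ?_ hlt
        rw [← Nat.card_eq_fintype_card]
        exact Set.ncard_le_card _)
      have hcirc : B.IsCircuit C := by rwa [← mcirc_iff, hBC]
      obtain ⟨z, hz⟩ := hC.2.2.1.1
      by_cases hPz : P z
      · refine hsp I sI hI C (fun w hw => ?_) hcirc
        rcases Finset.mem_union.1 (Finset.mem_coe.1 (hCs hw)) with h | h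
        · exact h
        · exact absurd (hP C hcirc z hz w hw hPz) (Finset.mem_filter.1 (hIA' h)).2
      · refine hsp I' sI' hI' C (fun w hw => ?_) hcirc
        rcases Finset.mem_union.1 (Finset.mem_coe.1 (hCs hw)) with h | h
        · exact absurd (hP C hcirc w hw z hz (Finset.mem_filter.1 (hIA h)).2) hPz
        · exact h
    · rw [Finset.mem_filter, SimpleGraph.mem_edgeFinset, ← hBE]
      exact ⟨hx, Or.inl rfl⟩
    · rw [Finset.mem_filter, SimpleGraph.mem_edgeFinset, ← hBE]
      refine ⟨hy, ?_⟩
      rintro (h | ⟨C, hC, h1, h2⟩)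
      · exact hxy h.symm
      · exact hno C ((mcirc_iff B C).2 hC) h1 h2
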